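/- Let λ > 0 be a real number. For all r₁, r₂ ∈ ℕ and every n ∈ ℕ, the modified degenerate Hermite-based tangent polynomials satisfy _HT_n^{(r₁+r₂)}(x+u, y+v:λ) = ∑_{k=0}^{n} C(n,k) · _HT_k^{(r₁)}(x,y:λ) · _HT_{n−k}^{(r₂)}(u,v:λ), for all real x, y, u, v. -/

import Mathlib

open PowerSeries Finset

/-- The formal power series `e^{a t}`. -/
noncomputable def expX (a : ℝ) : PowerSeries ℝ :=
  PowerSeries.mk fun n => a ^ n / n.factorial

/-- The formal power series `e^{a t^2}`. -/
noncomputable def expX2 (a : ℝ) : PowerSeries ℝ :=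
  PowerSeries.mk fun n => if 2 ∣ n then a ^ (n / 2) / (n / 2).factorial else 0

/-- The formal power series `e^{x t + y t^2}`. -/
noncomputable def expH (x y : ℝ) : PowerSeries ℝ := expX x * expX2 y

lemma expX_eq_rescale_exp (a : ℝ) : expX a = rescale a (exp ℝ) := by
  ext n
  simp [expX, coeff_rescale, coeff_exp, div_eq_mul_inv]

lemma expX_mul_expX (a b : ℝ) : expX a * expX b = expX (a + b) := by
  simp only [expX_eq_rescale_exp, exp_mul_exp_eq_exp_add]

lemma expX2_eq_expand (a : ℝ) : expX2 a = expand 2 two_ne_zero (expX a) := by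
  ext n
  rw [coeff_expand]
  simp [expX2, expX]

lemma expX2_mul_expX2 (a b : ℝ) : expX2 a * expX2 b = expX2 (a + b) := by
  simp only [expX2_eq_expand, ← map_mul, expX_mul_expX]

lemma expH_mul_expH (x y u v : ℝ) : expH x y * expH u v = expH (x + u) (y + v) := by
  rw [expH, expH, expH, ← expX_mul_expX, ← expX2_mul_expX2]
  ring

lemma expX_add_one_ne_zero (a : ℝ) : expX a + 1 ≠ 0 := by
  intro h
  have h0 := congrArg (coeff 0) h
  norm_num [expX] at h0

/-- The product of exponential generating functions, read off coefficientwise. -/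
lemma eq_sum_choose_of_mk_mul_mk {a b c : ℕ → ℝ}
    (h : (PowerSeries.mk fun n => c n / n.factorial) =
      (PowerSeries.mk fun n => a n / n.factorial) * PowerSeries.mk fun n => b n / n.factorial)
    (n : ℕ) : c n = ∑ k ∈ Finset.range (n + 1), (n.choose k : ℝ) * a k * b (n - k) := by
  have hn := congrArg (coeff n) h
  rw [coeff_mul, Nat.sum_antidiagonal_eq_sum_range_succ_mk] at hn
  simp only [coeff_mk] at hn
  rw [div_eq_iff (by positivity), Finset.sum_mul] at hn
  rw [hn]
  refine Finset.sum_congr rfl fun k hk => ?_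
  rw [Nat.cast_choose ℝ (Nat.lt_succ_iff.mp (Finset.mem_range.mp hk))]
  field_simp

/-- for λ > 0, `_HT_n^{(r₁+r₂)}(x+u,y+v:λ)
    = ∑_k C(n,k) _HT_k^{(r₁)}(x,y:λ) _HT_{n-k}^{(r₂)}(u,v:λ)`. -/
theorem modified_degenerate_hermite_tangent_order_addition
    (l : ℝ) (hl : 0 < l)
    (T : ℕ → ℕ → ℝ → ℝ → ℝ)
    (hT : ∀ r : ℕ, ∀ x y : ℝ,
      (PowerSeries.mk fun n => T r n x y / n.factorial) *
          (expX (2 * Real.log (1 + l) / l) + 1) ^ r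
        = 2 ^ r * expH (x * Real.log (1 + l) / l) (y * Real.log (1 + l) / l))
    (r₁ r₂ n : ℕ) (x y u v : ℝ) :
    T (r₁ + r₂) n (x + u) (y + v) =
      ∑ k ∈ Finset.range (n + 1), (n.choose k : ℝ) * T r₁ k x y * T r₂ (n - k) u v := by
  refine eq_sum_choose_of_mk_mul_mk (c := fun m => T (r₁ + r₂) m (x + u) (y + v))
    (a := fun m => T r₁ m x y) (b := fun m => T r₂ m u v) ?_ n
  apply mul_right_cancel₀ (pow_ne_zero (r₁ + r₂) (expX_add_one_ne_zero (2 * Real.log (1 + l) / l)))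
  rw [hT (r₁ + r₂), pow_add (expX _ + 1), mul_mul_mul_comm, hT r₁, hT r₂, mul_mul_mul_comm,
    expH_mul_expH, ← pow_add]
  simp only [add_mul, add_div]
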